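/- arXiv:1510.07190 — 3 statements merged into one kernel-verified Lean document; each statement's English description precedes it below -/
import Mathlib

section
/- Suppose j ≥ 3 and α = α_1⋯α_j and β = β_1⋯β_j are minimal overlapping permutations in S_j with α_1 = β_1, α_j = β_j, inv(α) = inv(β), and coinv(α) = coinv(β). Then for all n ≥ 1, mp_{α,n(j−1)+1}(p,q) = mp_{β,n(j−1)+1}(p,q), as polynomials in p and q. -/
open scoped Classical

noncomputable section

namespace CWilf

/-- The number of descents of a permutation of `{0, …, n-1}` (0-based). -/
def des {n : ℕ} (σ : Equiv.Perm (Fin n)) : ℕ :=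
  (Finset.univ.filter fun i : Fin n =>
    ∃ h : (i : ℕ) + 1 < n, σ ⟨(i : ℕ) + 1, h⟩ < σ i).card

/-- The number of inversions of `σ`. -/
def inv {n : ℕ} (σ : Equiv.Perm (Fin n)) : ℕ :=
  (Finset.univ.filter fun q : Fin n × Fin n => q.1 < q.2 ∧ σ q.2 < σ q.1).card

/-- The number of coinversions of `σ`. -/
def coinv {n : ℕ} (σ : Equiv.Perm (Fin n)) : ℕ :=
  (Finset.univ.filter fun q : Fin n × Fin n => q.1 < q.2 ∧ σ q.1 < σ q.2).card

/-- The number of left-to-right minima of `σ`. -/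
def LRmin {n : ℕ} (σ : Equiv.Perm (Fin n)) : ℕ :=
  (Finset.univ.filter fun j : Fin n => ∀ i : Fin n, i < j → σ j < σ i).card

/-- There is a `τ`-match of `σ` starting at (0-based) position `i`, i.e.
`red(σ_i σ_{i+1} ⋯ σ_{i+j-1}) = τ`. -/
def MatchAt {j n : ℕ} (τ : Equiv.Perm (Fin j)) (σ : Equiv.Perm (Fin n)) (i : ℕ) : Prop :=
  ∃ h : i + j ≤ n, ∀ a b : Fin j,
    τ a < τ b ↔
      σ ⟨i + (a : ℕ), by have := a.isLt; omega⟩ < σ ⟨i + (b : ℕ), by have := b.isLt; omega⟩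

/-- The number of `τ`-matches of `σ`. -/
def mch {j n : ℕ} (τ : Equiv.Perm (Fin j)) (σ : Equiv.Perm (Fin n)) : ℕ :=
  ((Finset.range n).filter fun i => MatchAt τ σ i).card

/-- `τ` is minimal overlapping: the smallest `n` such that some `σ ∈ S_n` has
exactly two `τ`-matches is `2j - 1`. -/
def MinOverlapping {j : ℕ} (τ : Equiv.Perm (Fin j)) : Prop :=
  IsLeast {n : ℕ | ∃ σ : Equiv.Perm (Fin n), mch τ σ = 2} (2 * j - 1)

/-- `α` and `β` are mutually minimal overlapping. -/
def MutuallyMinOverlapping {j : ℕ} (α β : Equiv.Perm (Fin j)) : Prop :=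
  MinOverlapping α ∧ MinOverlapping β ∧
    IsLeast {n : ℕ | ∃ σ : Equiv.Perm (Fin n), 1 ≤ mch α σ ∧ 1 ≤ mch β σ} (2 * j - 1)

/-- The set of permutations of `S_n` with no `τ`-match. -/
def NM (n : ℕ) {j : ℕ} (τ : Equiv.Perm (Fin j)) : Finset (Equiv.Perm (Fin n)) :=
  Finset.univ.filter fun σ => mch τ σ = 0

/-- The `p,q`-analogue `[n]_{p,q} = p^{n-1} + p^{n-2}q + ⋯ + q^{n-1}`. -/
def pqInt {K : Type} [CommSemiring K] (p q : K) (n : ℕ) : K :=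
  ∑ i ∈ Finset.range n, p ^ (n - 1 - i) * q ^ i

/-- The `p,q`-factorial `[n]_{p,q}!`. -/
def pqFact {K : Type} [CommSemiring K] (p q : K) : ℕ → K
  | 0 => 1
  | n + 1 => pqFact p q n * pqInt p q (n + 1)

/-- The `p,q`-binomial coefficient, taken to be `0` when `k > n`. -/
def pqBinom {K : Type} [Field K] (p q : K) (n k : ℕ) : K :=
  if k ≤ n then pqFact p q n / (pqFact p q k * pqFact p q (n - k)) else 0

/-- The `q`-analogue `[n]_q = 1 + q + ⋯ + q^{n-1}`. -/
def qInt {K : Type} [CommSemiring K] (q : K) (n : ℕ) : K :=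
  ∑ i ∈ Finset.range n, q ^ i

/-- The `q`-factorial `[n]_q!`. -/
def qFact {K : Type} [CommSemiring K] (q : K) : ℕ → K
  | 0 => 1
  | n + 1 => qFact q n * qInt q (n + 1)

/-- The `q`-binomial coefficient, taken to be `0` when `k > n`. -/
def qBinom {K : Type} [Field K] (q : K) (n k : ℕ) : K :=
  if k ≤ n then qFact q n / (qFact q k * qFact q (n - k)) else 0

/-- `mp_{τ, n(j-1)+1}(p,q)`, the generating polynomial
`Σ_{σ ∈ MP_{τ,n(j-1)+1}} q^{inv σ} p^{coinv σ}` over maximum packings for `τ`. -/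
def mpSum {j : ℕ} (τ : Equiv.Perm (Fin j)) (n : ℕ) {K : Type} [CommSemiring K] (p q : K) : K :=
  ∑ σ ∈ Finset.univ.filter (fun σ : Equiv.Perm (Fin (n * (j - 1) + 1)) => mch τ σ = n),
    q ^ inv σ * p ^ coinv σ

/-- Every injective word on `Fin m` has a reduction, a permutation with the same relative order. -/
theorem exists_perm_lt_iff {m : ℕ} {ι : Type*} [LinearOrder ι] (f : Fin m → ι)
    (hf : Function.Injective f) :
    ∃ ρ : Equiv.Perm (Fin m), ∀ a b, ρ a < ρ b ↔ f a < f b := by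
  have hmono : StrictMono (f ∘ Tuple.sort f) :=
    (Tuple.monotone_sort f).strictMono_of_injective (hf.comp (Tuple.sort f).injective)
  refine ⟨(Tuple.sort f)⁻¹, fun a b => ?_⟩
  simpa using (hmono.lt_iff_lt (a := (Tuple.sort f)⁻¹ a) (b := (Tuple.sort f)⁻¹ b)).symm

/-- Distinct matches of a minimal overlapping permutation share at most one position. -/
theorem MinOverlapping.add_le_of_matchAt {d n : ℕ} {τ : Equiv.Perm (Fin (d + 1))}
    (hτ : MinOverlapping τ) {σ : Equiv.Perm (Fin n)} {i i' : ℕ} (hi : MatchAt τ σ i)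
    (hi' : MatchAt τ σ i') (hlt : i < i') : i + d ≤ i' := by
  by_contra! hclose
  have hex : ∃ s, 0 < s ∧ MatchAt τ σ (i + s) :=
    ⟨i' - i, by omega, by rwa [Nat.add_sub_cancel' hlt.le]⟩
  obtain ⟨s, ⟨hs0, hs⟩, hmin⟩ : ∃ s, (0 < s ∧ MatchAt τ σ (i + s)) ∧
      ∀ t, 0 < t → MatchAt τ σ (i + t) → s ≤ t :=
    ⟨Nat.find hex, Nat.find_spec hex, fun t h0 h => Nat.find_min' hex ⟨h0, h⟩⟩
  have hsd : s < d := by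
    have := hmin (i' - i) (by omega) (by rwa [Nat.add_sub_cancel' hlt.le])
    omega
  have hsn : i + s + (d + 1) ≤ n := hs.1
  obtain ⟨ρ, hρ⟩ := exists_perm_lt_iff
    (fun a : Fin (s + (d + 1)) => σ ⟨i + a, by have := a.isLt; omega⟩) (by
      intro a b hab
      have := congrArg Fin.val (σ.injective hab)
      simp only at this
      exact Fin.ext (by omega))
  have hmatch : ∀ t, t ≤ s → (MatchAt τ ρ t ↔ MatchAt τ σ (i + t)) := by
    intro t ht
    constructor
    · rintro ⟨h, hab⟩
      refine ⟨by omega, fun a b => ?_⟩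
      rw [hab a b, hρ]
      simp only [add_assoc]
    · rintro ⟨h, hab⟩
      refine ⟨by omega, fun a b => ?_⟩
      rw [hab a b, hρ]
      simp only [add_assoc]
  have hcard : mch τ ρ = 2 := by
    have : ((Finset.range (s + (d + 1))).filter fun t => MatchAt τ ρ t) = {0, s} := by
      ext t
      simp only [Finset.mem_filter, Finset.mem_range, Finset.mem_insert, Finset.mem_singleton]
      constructor
      · rintro ⟨-, ht⟩
        have hts : t ≤ s := by have := ht.1; omega
        rcases Nat.eq_zero_or_pos t with h0 | h0
        · exact Or.inl h0
        · exact Or.inr (le_antisymm hts (hmin t h0 ((hmatch t hts).1 ht)))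
      · rintro (rfl | rfl)
        · exact ⟨by omega, (hmatch 0 (Nat.zero_le _)).2 hi⟩
        · exact ⟨by omega, (hmatch _ le_rfl).2 hs⟩
    rw [mch, this, Finset.card_pair hs0.ne]
  have := hτ.2 ⟨ρ, hcard⟩
  omega

/-- The maximum packings of a minimal overlapping permutation of length `d + 1` are the
permutations that match it at every multiple of `d`. -/
theorem MinOverlapping.mch_eq_iff {d n : ℕ} (hd : 0 < d) {τ : Equiv.Perm (Fin (d + 1))}
    (hτ : MinOverlapping τ) (σ : Equiv.Perm (Fin (n * d + 1))) :
    mch τ σ = n ↔ ∀ k < n, MatchAt τ σ (k * d) := by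
  set M := (Finset.range (n * d + 1)).filter fun i => MatchAt τ σ i with hM
  have hmem : ∀ x, x ∈ M ↔ MatchAt τ σ x := fun x => by
    simp only [hM, Finset.mem_filter, Finset.mem_range, and_iff_right_iff_imp]
    intro h
    have := h.1
    omega
  have hmaps : ∀ x ∈ M, x / d ∈ Finset.range n := fun x hx => by
    have := ((hmem x).1 hx).1
    rw [Finset.mem_range, Nat.div_lt_iff_lt_mul hd]
    omega
  have hinj : Set.InjOn (fun x => x / d) (M : Set ℕ) := by
    have key : ∀ x ∈ M, ∀ y ∈ M, x / d = y / d → ¬ x < y := fun x hx y hy hxy hlt => by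
      have h := Nat.div_le_div_right (c := d)
        (hτ.add_le_of_matchAt ((hmem x).1 hx) ((hmem y).1 hy) hlt)
      rw [Nat.add_div_right _ hd] at h
      omega
    intro x hx y hy hxy
    have h₁ := key x hx y hy hxy
    have h₂ := key y hy x hx hxy.symm
    omega
  constructor
  · intro hcard
    have hsurj : ∀ k < n, ∃ x, MatchAt τ σ x ∧ x / d = k := by
      have himage : M.image (fun x => x / d) = Finset.range n := by
        apply Finset.eq_of_subset_of_card_le
        · intro k hk
          obtain ⟨x, hx, rfl⟩ := Finset.mem_image.1 hk
          exact hmaps x hx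
        · rw [Finset.card_image_of_injOn hinj, Finset.card_range]
          exact hcard.ge
      intro k hk
      rw [← Finset.mem_range, ← himage] at hk
      obtain ⟨x, hx, hxk⟩ := Finset.mem_image.1 hk
      exact ⟨x, (hmem x).1 hx, hxk⟩
    have main : ∀ t k, k + t + 1 = n → MatchAt τ σ (k * d) := by
      intro t
      induction t with
      | zero =>
        intro k hk
        obtain ⟨x, hx, hxk⟩ := hsurj k (by omega)
        have h₁ := Nat.div_mul_le_self x d
        have h₂ := hx.1
        rw [hxk] at h₁
        subst hk
        rw [add_zero, add_mul, one_mul] at h₂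
        rwa [show k * d = x by omega]
      | succ t ih =>
        intro k hk
        obtain ⟨x, hx, hxk⟩ := hsurj k (by omega)
        have h₁ := Nat.div_mul_le_self x d
        have h₂ := Nat.lt_div_mul_add hd (a := x)
        have h₃ := hτ.add_le_of_matchAt hx (ih (k + 1) (by omega))
          (by rw [add_mul, one_mul, ← hxk]; exact h₂)
        rw [hxk] at h₁
        rw [add_mul, one_mul] at h₃
        rwa [show k * d = x by omega]
    intro k hk
    exact main (n - k - 1) k (by omega)
  · intro h
    apply le_antisymm
    · have := Finset.card_le_card_of_injOn (t := Finset.range n) (fun x => x / d) hmaps hinj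
      rwa [Finset.card_range] at this
    · have := Finset.card_le_card_of_injOn (s := Finset.range n) (t := M) (fun k => k * d)
        (fun k hk => (hmem _).2 (h k (Finset.mem_range.1 hk)))
        (fun a _ b _ hab => Nat.eq_of_mul_eq_mul_right hd hab)
      rwa [Finset.card_range] at this

section BlockPerm

variable {d : ℕ}

/-- The action of `γ` on each of the blocks `{k * d, …, (k + 1) * d}` of positions. -/
def blockMap (γ : Equiv.Perm (Fin (d + 1))) (x : ℕ) : ℕ :=
  x / d * d + γ (Fin.ofNat (d + 1) (x % d))

variable {γ : Equiv.Perm (Fin (d + 1))}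

theorem ofNat_mod_eq (hd : 0 < d) (x : ℕ) :
    Fin.ofNat (d + 1) (x % d) = ⟨x % d, (Nat.mod_lt x hd).trans (Nat.lt_succ_self d)⟩ :=
  Fin.ext (Nat.mod_eq_of_lt ((Nat.mod_lt x hd).trans (Nat.lt_succ_self d)))

theorem apply_mod_lt (hd : 0 < d) (hγ : γ (Fin.last d) = Fin.last d) (x : ℕ) :
    (γ (Fin.ofNat (d + 1) (x % d)) : ℕ) < d := by
  rw [ofNat_mod_eq hd]
  refine lt_of_le_of_ne (Nat.lt_succ_iff.1 (Fin.isLt _)) fun h => ?_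
  have h' : γ ⟨x % d, (Nat.mod_lt x hd).trans (Nat.lt_succ_self d)⟩ = γ (Fin.last d) := by
    rw [hγ]; exact Fin.ext h
  have := congrArg Fin.val (γ.injective h')
  have := Nat.mod_lt x hd
  simp only [Fin.val_last] at *
  omega

theorem blockMap_div (hd : 0 < d) (hγ : γ (Fin.last d) = Fin.last d) (x : ℕ) :
    blockMap γ x / d = x / d := by
  rw [blockMap, add_comm, Nat.add_mul_div_right _ _ hd, Nat.div_eq_of_lt (apply_mod_lt hd hγ x),
    zero_add]

theorem blockMap_mod (hd : 0 < d) (hγ : γ (Fin.last d) = Fin.last d) (x : ℕ) :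
    blockMap γ x % d = γ (Fin.ofNat (d + 1) (x % d)) := by
  rw [blockMap, add_comm, Nat.add_mul_mod_self_right, Nat.mod_eq_of_lt (apply_mod_lt hd hγ x)]

theorem blockMap_symm_blockMap (hd : 0 < d) (hγ : γ (Fin.last d) = Fin.last d) (x : ℕ) :
    blockMap γ.symm (blockMap γ x) = x := by
  rw [blockMap, blockMap_div hd hγ, blockMap_mod hd hγ]
  simp only [Fin.ofNat_eq_cast, Fin.cast_val_eq_self, Equiv.symm_apply_apply]
  rw [← Fin.ofNat_eq_cast, ofNat_mod_eq hd]
  exact Nat.div_add_mod' x d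

theorem symm_apply_of_apply_eq {ι : Type*} {e : Equiv.Perm ι} {x : ι} (h : e x = x) :
    e.symm x = x :=
  e.symm_apply_eq.2 h.symm

theorem blockMap_mul_add (hd : 0 < d) (h0 : γ 0 = 0) (hγ : γ (Fin.last d) = Fin.last d) (k : ℕ)
    (a : Fin (d + 1)) : blockMap γ (k * d + a) = k * d + γ a := by
  rcases (Nat.lt_succ_iff.1 a.isLt).lt_or_eq with h | h
  · rw [blockMap, add_comm (k * d), Nat.add_mul_div_right _ _ hd, Nat.div_eq_of_lt h, zero_add,
      Nat.add_mul_mod_self_right, Nat.mod_eq_of_lt h]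
    simp
  · have ha : a = Fin.last d := Fin.ext h
    subst ha
    rw [hγ, Fin.val_last, ← Nat.succ_mul, blockMap, Nat.mul_div_cancel _ hd, Nat.mul_mod_left]
    simp [h0]

theorem blockMap_lt (hd : 0 < d) (h0 : γ 0 = 0) (hγ : γ (Fin.last d) = Fin.last d) {n x : ℕ}
    (hx : x < n * d + 1) : blockMap γ x < n * d + 1 := by
  rcases (Nat.lt_succ_iff.1 hx).lt_or_eq with h | rfl
  · have h₁ : blockMap γ x / d < n := by
      rw [blockMap_div hd hγ]
      exact (Nat.div_lt_iff_lt_mul hd).2 h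
    exact ((Nat.div_lt_iff_lt_mul hd).1 h₁).trans (Nat.lt_succ_self _)
  · have := blockMap_mul_add hd h0 hγ n 0
    simp only [Fin.val_zero, add_zero, h0] at this
    rw [this]
    exact hx

theorem blockMap_separated (hd : 0 < d) (h0 : γ 0 = 0) (hγ : γ (Fin.last d) = Fin.last d)
    {x y : ℕ} (h : (x / d + 1) * d < y) : (blockMap γ x / d + 1) * d < blockMap γ y := by
  rw [blockMap_div hd hγ]
  have hle : x / d + 1 ≤ y / d := (Nat.le_div_iff_mul_le hd).2 h.le
  rcases hle.lt_or_eq with h₁ | h₁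
  · calc (x / d + 1) * d < (y / d) * d := Nat.mul_lt_mul_of_pos_right h₁ hd
      _ ≤ blockMap γ y := Nat.le_add_right _ _
  · rw [blockMap, ← h₁]
    refine Nat.lt_add_of_pos_right (Nat.pos_of_ne_zero fun hz => ?_)
    have h₂ : γ (Fin.ofNat (d + 1) (y % d)) = γ 0 := by
      rw [h0]; exact Fin.ext hz
    have h₃ := congrArg Fin.val (γ.injective h₂)
    rw [ofNat_mod_eq hd] at h₃
    simp only [Fin.val_zero] at h₃
    have := Nat.div_add_mod' y d
    rw [← h₁, h₃] at this
    omega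

/-- The permutation of `{0, …, n * d}` acting as `γ` on each of the blocks
`{k * d, …, (k + 1) * d}`, where `γ` fixes both endpoints. -/
def blockPerm (hd : 0 < d) (h0 : γ 0 = 0) (hγ : γ (Fin.last d) = Fin.last d) (n : ℕ) :
    Equiv.Perm (Fin (n * d + 1)) where
  toFun x := ⟨blockMap γ x, blockMap_lt hd h0 hγ x.isLt⟩
  invFun x := ⟨blockMap γ.symm x,
    blockMap_lt hd (symm_apply_of_apply_eq h0) (symm_apply_of_apply_eq hγ) x.isLt⟩
  left_inv x := Fin.ext (blockMap_symm_blockMap hd hγ x)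
  right_inv x := Fin.ext (blockMap_symm_blockMap (γ := γ.symm) hd (symm_apply_of_apply_eq hγ) x)

theorem blockPerm_separated_iff (hd : 0 < d) (h0 : γ 0 = 0) (hγ : γ (Fin.last d) = Fin.last d)
    {n : ℕ} (x y : Fin (n * d + 1)) :
    ((blockPerm hd h0 hγ n x : ℕ) / d + 1) * d < blockPerm hd h0 hγ n y ↔
      ((x : ℕ) / d + 1) * d < y := by
  refine ⟨fun h => ?_, blockMap_separated hd h0 hγ⟩
  have := blockMap_separated hd (symm_apply_of_apply_eq h0) (symm_apply_of_apply_eq hγ) h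
  simpa only [blockPerm, Equiv.coe_fn_mk, blockMap_symm_blockMap hd hγ] using this

end BlockPerm

theorem mul_add_lt {d n k : ℕ} (hk : k < n) (a : Fin (d + 1)) : k * d + a < n * d + 1 := by
  have h₁ := Nat.mul_le_mul_right d (Nat.succ_le_of_lt hk)
  rw [Nat.succ_mul] at h₁
  have := a.isLt
  omega

/-- The pairs satisfying `P` split into the pairs inside a block and the separated pairs. -/
theorem card_filter_lt_and {d n : ℕ} (hd : 0 < d) (P : Fin (n * d + 1) → Fin (n * d + 1) → Prop)
    (Q : Fin (d + 1) → Fin (d + 1) → Prop) [DecidableRel P] [DecidableRel Q]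
    (hPQ : ∀ k (hk : k < n) (a b), Q a b ↔ P ⟨k * d + a, mul_add_lt hk a⟩
      ⟨k * d + b, mul_add_lt hk b⟩) :
    (Finset.univ.filter fun q : Fin (n * d + 1) × Fin (n * d + 1) =>
      q.1 < q.2 ∧ P q.1 q.2).card =
    n * (Finset.univ.filter fun q : Fin (d + 1) × Fin (d + 1) => q.1 < q.2 ∧ Q q.1 q.2).card +
    (Finset.univ.filter fun q : Fin (n * d + 1) × Fin (n * d + 1) =>
      ((q.1 : ℕ) / d + 1) * d < q.2 ∧ P q.1 q.2).card := by
  have hlt : ∀ x : ℕ, x < (x / d + 1) * d := fun x => by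
    rw [add_mul, one_mul]
    exact Nat.lt_div_mul_add hd
  rw [← Finset.card_filter_add_card_filter_not (fun q => (q.2 : ℕ) ≤ ((q.1 : ℕ) / d + 1) * d),
    Finset.filter_filter, Finset.filter_filter]
  congr 1
  · have hdiv : ∀ (k : ℕ) {a b : Fin (d + 1)}, a < b → (k * d + a) / d = k := fun k a b hab => by
      have hb := b.isLt
      rw [Fin.lt_def] at hab
      rw [add_comm, Nat.add_mul_div_right _ _ hd, Nat.div_eq_of_lt (by omega), zero_add]
    have hcard : ∀ F : Finset (Fin (d + 1) × Fin (d + 1)),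
        n * F.card = ((Finset.univ : Finset (Fin n)) ×ˢ F).card := fun F => by
      rw [Finset.card_product, Finset.card_univ, Fintype.card_fin]
    rw [hcard]
    symm
    refine Finset.card_bij (fun r _ => (⟨r.1 * d + r.2.1, mul_add_lt r.1.isLt r.2.1⟩,
      ⟨r.1 * d + r.2.2, mul_add_lt r.1.isLt r.2.2⟩)) ?_ ?_ ?_
    · rintro ⟨k, a, b⟩ h
      simp only [Finset.mem_product, Finset.mem_filter, Finset.mem_univ, true_and] at h ⊢
      refine ⟨⟨?_, (hPQ k k.isLt a b).1 h.2⟩, ?_⟩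
      · rw [Fin.lt_def]
        exact Nat.add_lt_add_left h.1 _
      · rw [hdiv k h.1, add_mul, one_mul]
        exact Nat.add_le_add_left (Nat.lt_succ_iff.1 b.isLt) _
    · rintro ⟨k, a, b⟩ h ⟨k', a', b'⟩ h' heq
      simp only [Finset.mem_product, Finset.mem_filter, Finset.mem_univ, true_and] at h h'
      simp only [Prod.mk.injEq, Fin.mk.injEq] at heq
      have hk := congrArg (· / d) heq.1
      simp only [hdiv _ h.1, hdiv _ h'.1] at hk
      rw [hk] at heq
      simp only [Prod.mk.injEq, Fin.ext_iff]
      omega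
    · rintro ⟨x, y⟩ h
      simp only [Finset.mem_filter, Finset.mem_univ, true_and] at h
      obtain ⟨⟨hxy, hP⟩, hy⟩ := h
      rw [Fin.lt_def] at hxy
      have hk : (x : ℕ) / d < n := by
        rw [Nat.div_lt_iff_lt_mul hd]
        have := y.isLt
        omega
      have hx := Nat.div_add_mod' (x : ℕ) d
      have hxd := Nat.mod_lt (x : ℕ) hd
      rw [add_mul, one_mul] at hy
      have hx' : (⟨(x : ℕ) / d * d + x % d, by omega⟩ : Fin (n * d + 1)) = x := Fin.ext hx
      have hy' : (⟨(x : ℕ) / d * d + (y - x / d * d), by omega⟩ : Fin (n * d + 1)) = y :=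
        Fin.ext (by simp only; omega)
      refine ⟨(⟨x / d, hk⟩, ⟨x % d, by omega⟩, ⟨y - x / d * d, by omega⟩), ?_, ?_⟩
      · simp only [Finset.mem_product, Finset.mem_filter, Finset.mem_univ, true_and, Fin.lt_def]
        refine ⟨by omega, (hPQ _ hk _ _).2 ?_⟩
        simpa only [hx', hy'] using hP
      · simp only [hx', hy']
  · congr 1
    ext q
    simp only [Finset.mem_filter, Finset.mem_univ, true_and, not_le]
    constructor
    · rintro ⟨⟨-, hP⟩, h⟩
      exact ⟨h, hP⟩
    · rintro ⟨h, hP⟩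
      exact ⟨⟨(hlt q.1).trans h, hP⟩, h⟩

/-- Rearranging the blocks changes the number of related pairs only inside the blocks. -/
theorem card_filter_lt_and_comp_blockPerm {d n : ℕ} (hd : 0 < d) {γ : Equiv.Perm (Fin (d + 1))}
    (h0 : γ 0 = 0) (hγ : γ (Fin.last d) = Fin.last d)
    (P : Fin (n * d + 1) → Fin (n * d + 1) → Prop) (Q Q' : Fin (d + 1) → Fin (d + 1) → Prop)
    [DecidableRel P] [DecidableRel Q] [DecidableRel Q']
    (hPQ : ∀ k (hk : k < n) (a b), Q a b ↔ P ⟨k * d + a, mul_add_lt hk a⟩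
      ⟨k * d + b, mul_add_lt hk b⟩)
    (hQ' : ∀ a b, Q' a b ↔ Q (γ a) (γ b))
    (hcard : (Finset.univ.filter fun q : Fin (d + 1) × Fin (d + 1) =>
        q.1 < q.2 ∧ Q q.1 q.2).card =
      (Finset.univ.filter fun q : Fin (d + 1) × Fin (d + 1) => q.1 < q.2 ∧ Q' q.1 q.2).card) :
    (Finset.univ.filter fun q : Fin (n * d + 1) × Fin (n * d + 1) =>
      q.1 < q.2 ∧ P (blockPerm hd h0 hγ n q.1) (blockPerm hd h0 hγ n q.2)).card =
    (Finset.univ.filter fun q : Fin (n * d + 1) × Fin (n * d + 1) =>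
      q.1 < q.2 ∧ P q.1 q.2).card := by
  rw [card_filter_lt_and hd P Q hPQ, hcard, card_filter_lt_and hd
    (fun x y => P (blockPerm hd h0 hγ n x) (blockPerm hd h0 hγ n y)) Q' ?_]
  · congr 1
    refine Finset.card_equiv (Equiv.prodCongr (blockPerm hd h0 hγ n) (blockPerm hd h0 hγ n))
      fun q => ?_
    simp [blockPerm_separated_iff]
  · intro k hk a b
    rw [hQ', hPQ k hk]
    simp only [blockPerm, Equiv.coe_fn_mk, blockMap_mul_add hd h0 hγ]

theorem matchAt_iff {d n k : ℕ} (hk : k < n) (τ : Equiv.Perm (Fin (d + 1)))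
    (σ : Equiv.Perm (Fin (n * d + 1))) :
    MatchAt τ σ (k * d) ↔ ∀ a b : Fin (d + 1), τ a < τ b ↔
      σ ⟨k * d + a, mul_add_lt hk a⟩ < σ ⟨k * d + b, mul_add_lt hk b⟩ :=
  ⟨fun h => h.2, fun h => ⟨by
    have := mul_add_lt hk (Fin.last d)
    rw [Fin.val_last] at this
    omega, h⟩⟩

theorem matchAt_mul_blockPerm_iff {d n k : ℕ} (hd : 0 < d) {γ : Equiv.Perm (Fin (d + 1))}
    (h0 : γ 0 = 0) (hγ : γ (Fin.last d) = Fin.last d) (hk : k < n)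
    (τ : Equiv.Perm (Fin (d + 1))) (σ : Equiv.Perm (Fin (n * d + 1))) :
    MatchAt (τ * γ) (σ * blockPerm hd h0 hγ n) (k * d) ↔ MatchAt τ σ (k * d) := by
  rw [matchAt_iff hk, matchAt_iff hk, γ.forall_congr_left]
  refine forall_congr' fun a => ?_
  rw [γ.forall_congr_left]
  refine forall_congr' fun b => ?_
  simp [blockPerm, blockMap_mul_add hd h0 hγ]

/-- Theorem (Duane–Remmel): if `α, β ∈ S_j` (`j ≥ 3`) are minimal overlapping with
`α_1 = β_1`, `α_j = β_j`, `inv α = inv β` and `coinv α = coinv β`, then for all `n ≥ 1`,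
`mp_{α,n(j-1)+1}(p,q) = mp_{β,n(j-1)+1}(p,q)` as polynomials in `p` (= `X 0`) and
`q` (= `X 1`). -/
theorem stmt5 {j : ℕ} (hj : 3 ≤ j) (α β : Equiv.Perm (Fin j))
    (hα : MinOverlapping α) (hβ : MinOverlapping β)
    (hfirst : α ⟨0, by omega⟩ = β ⟨0, by omega⟩)
    (hlast : α ⟨j - 1, by omega⟩ = β ⟨j - 1, by omega⟩)
    (hinv : inv α = inv β) (hcoinv : coinv α = coinv β) :
    ∀ n : ℕ, 1 ≤ n →
      mpSum α n (MvPolynomial.X 0 : MvPolynomial (Fin 2) ℚ) (MvPolynomial.X 1) =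
      mpSum β n (MvPolynomial.X 0 : MvPolynomial (Fin 2) ℚ) (MvPolynomial.X 1) := by
  obtain ⟨d, rfl⟩ : ∃ d, j = d + 1 := ⟨j - 1, by omega⟩
  intro n _
  have hd : 0 < d := by omega
  set γ : Equiv.Perm (Fin (d + 1)) := α⁻¹ * β with hγdef
  have hβγ : β = α * γ := by rw [hγdef, mul_inv_cancel_left]
  have h0 : γ 0 = 0 := by
    rw [hγdef, Equiv.Perm.mul_apply, Equiv.Perm.inv_eq_iff_eq]
    exact hfirst.symm
  have hγ : γ (Fin.last d) = Fin.last d := by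
    rw [hγdef, Equiv.Perm.mul_apply, Equiv.Perm.inv_eq_iff_eq]
    exact hlast.symm
  change (∑ σ ∈ Finset.univ.filter (fun σ : Equiv.Perm (Fin (n * d + 1)) => mch α σ = n), _) =
    ∑ σ ∈ Finset.univ.filter (fun σ : Equiv.Perm (Fin (n * d + 1)) => mch β σ = n), _
  refine Finset.sum_equiv (Equiv.mulRight (blockPerm hd h0 hγ n)) (fun σ => ?_) fun σ hσ => ?_
  · simp only [Finset.mem_filter, Finset.mem_univ, true_and, Equiv.coe_mulRight]
    rw [hα.mch_eq_iff hd, hβ.mch_eq_iff hd, hβγ]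
    exact forall₂_congr fun k hk => (matchAt_mul_blockPerm_iff hd h0 hγ hk α σ).symm
  · simp only [Finset.mem_filter, Finset.mem_univ, true_and] at hσ
    have hmatch := fun k hk => (matchAt_iff hk α σ).1 ((hα.mch_eq_iff hd σ).1 hσ k hk)
    have hi : inv (σ * blockPerm hd h0 hγ n) = inv σ :=
      card_filter_lt_and_comp_blockPerm hd h0 hγ (fun x y => σ y < σ x) (fun a b => α b < α a)
        (fun a b => β b < β a) (fun k hk a b => hmatch k hk b a) (fun a b => by simp [hβγ]) hinv
    have hc : coinv (σ * blockPerm hd h0 hγ n) = coinv σ :=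
      card_filter_lt_and_comp_blockPerm hd h0 hγ (fun x y => σ x < σ y) (fun a b => α a < α b)
        (fun a b => β a < β b) hmatch (fun a b => by simp [hβγ]) hcoinv
    simp only [Equiv.coe_mulRight]
    rw [hi, hc]

end CWilf
end
end

section
/- Suppose j ≥ 3 and α = α_1⋯α_j and β = β_1⋯β_j are minimal overlapping permutations in S_j with α_1 = β_1 = 1, α_j = β_j, and des(α) = des(β). Then for all n ≥ 0, Σ_{σ∈NM_n(α)} x^{des(σ)} = Σ_{σ∈NM_n(β)} x^{des(σ)}, as polynomials in x; that is, α and β are des-c-Wilf equivalent. -/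
open scoped Classical

noncomputable section

namespace CWilf

/-- The permutation `σ` has a descent at the (0-based) position `k`. -/
def DescAt {n : ℕ} (σ : Equiv.Perm (Fin n)) (k : ℕ) : Prop :=
  ∃ h : k + 1 < n, σ ⟨k + 1, h⟩ < σ ⟨k, by omega⟩

theorem des_eq_card_range {n : ℕ} (σ : Equiv.Perm (Fin n)) :
    des σ = ((Finset.range n).filter (DescAt σ)).card := by
  unfold des
  refine Finset.card_bij (fun i _ => (i : ℕ)) ?_ ?_ ?_
  · intro i hi
    simp only [Finset.mem_filter, Finset.mem_univ, true_and, Finset.mem_range] at hi ⊢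
    exact ⟨i.isLt, hi⟩
  · intro a _ b _ h
    exact Fin.ext h
  · intro k hk
    simp only [Finset.mem_filter, Finset.mem_univ, true_and, Finset.mem_range] at hk ⊢
    exact ⟨⟨k, hk.1⟩, hk.2, rfl⟩

theorem card_descAt_window {j n : ℕ} {τ : Equiv.Perm (Fin j)} {σ : Equiv.Perm (Fin n)} {i : ℕ}
    (hm : MatchAt τ σ i) :
    ((Finset.range n).filter fun k => DescAt σ k ∧ i ≤ k ∧ k + 1 < i + j).card = des τ := by
  obtain ⟨h, hm⟩ := hm
  rw [des_eq_card_range]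
  symm
  refine Finset.card_bij (fun k _ => i + k) ?_ ?_ ?_
  · intro k hk
    simp only [Finset.mem_filter, Finset.mem_range] at hk ⊢
    obtain ⟨_, hk1, hk⟩ := hk
    have hd := (hm ⟨k + 1, hk1⟩ ⟨k, by omega⟩).1 hk
    exact ⟨by omega, ⟨by omega, hd⟩, by omega, by omega⟩
  · intro a _ b _ hab
    exact Nat.add_left_cancel hab
  · intro k hk
    simp only [Finset.mem_filter, Finset.mem_range] at hk
    obtain ⟨_, ⟨hk1, hk⟩, hik, hkj⟩ := hk
    obtain ⟨m, rfl⟩ := Nat.exists_eq_add_of_le hik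
    refine ⟨m, ?_, rfl⟩
    simp only [Finset.mem_filter, Finset.mem_range]
    exact ⟨by omega, by omega, (hm ⟨m + 1, by omega⟩ ⟨m, by omega⟩).2 hk⟩

theorem des_eq_add_of_matchAt {j n : ℕ} {τ : Equiv.Perm (Fin j)} {σ : Equiv.Perm (Fin n)} {i : ℕ}
    (hm : MatchAt τ σ i) :
    des σ = des τ +
      ((Finset.range n).filter fun k => DescAt σ k ∧ ¬ (i ≤ k ∧ k + 1 < i + j)).card := by
  rw [← card_descAt_window hm, des_eq_card_range,
    ← Finset.card_filter_add_card_filter_not (fun k => i ≤ k ∧ k + 1 < i + j),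
    Finset.filter_filter, Finset.filter_filter]

/-- Every injective word of length `N` has the same relative order as some permutation. -/
theorem exists_perm_lt_iff_s7 {N n : ℕ} (g : Fin N → Fin n) (hg : Function.Injective g) :
    ∃ p : Equiv.Perm (Fin N), ∀ a b, p a < p b ↔ g a < g b := by
  refine ⟨(Tuple.sort g)⁻¹, fun a b => ?_⟩
  have hs : StrictMono (g ∘ Tuple.sort g) :=
    (Tuple.monotone_sort g).strictMono_of_injective (hg.comp (Tuple.sort g).injective)
  rw [← hs.lt_iff_lt]
  simp

/-- Distinct matches of a minimal overlapping permutation share at most one position. -/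
theorem MinOverlapping.le_of_matchAt {j n : ℕ} (hj : 3 ≤ j) {τ : Equiv.Perm (Fin j)}
    (hτ : MinOverlapping τ) {σ : Equiv.Perm (Fin n)} {i k : ℕ} (hi : MatchAt τ σ i)
    (hk : MatchAt τ σ k) (hik : i < k) : i + j ≤ k + 1 := by
  have hex : ∃ d, 0 < d ∧ MatchAt τ σ (i + d) :=
    ⟨k - i, by omega, by rwa [Nat.add_sub_cancel' hik.le]⟩
  set d := Nat.find hex
  obtain ⟨hd0, hdm⟩ : 0 < d ∧ MatchAt τ σ (i + d) := Nat.find_spec hex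
  have hmin : ∀ m, 0 < m → MatchAt τ σ (i + m) → d ≤ m := fun m h1 h2 =>
    Nat.find_min' hex ⟨h1, h2⟩
  have hdk : d ≤ k - i := hmin _ (by omega) (by rwa [Nat.add_sub_cancel' hik.le])
  have hn : i + d + j ≤ n := hdm.1
  obtain ⟨p, hp⟩ := exists_perm_lt_iff_s7
    (fun a : Fin (d + j) => σ ⟨i + a, by have := a.isLt; omega⟩)
    (fun a b hab => by
      have := congrArg Fin.val (σ.injective hab)
      simp only at this
      exact Fin.ext (by omega))
  have hmatch : ∀ m, m ≤ d → (MatchAt τ p m ↔ MatchAt τ σ (i + m)) := by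
    intro m hm
    constructor
    · rintro ⟨_, hτp⟩
      refine ⟨by omega, fun a b => ?_⟩
      rw [hτp, hp]
      simp only [Nat.add_assoc]
    · rintro ⟨_, hτσ⟩
      refine ⟨by omega, fun a b => ?_⟩
      rw [hτσ, hp]
      simp only [Nat.add_assoc]
  have hcard : mch τ p = 2 := by
    have hset : ((Finset.range (d + j)).filter fun m => MatchAt τ p m) = {0, d} := by
      ext m
      simp only [Finset.mem_filter, Finset.mem_range, Finset.mem_insert, Finset.mem_singleton]
      constructor
      · rintro ⟨_, hm⟩
        have hmd : m ≤ d := by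
          have := hm.1
          omega
        rcases Nat.eq_zero_or_pos m with h0 | h0
        · exact Or.inl h0
        · exact Or.inr (le_antisymm hmd (hmin m h0 ((hmatch m hmd).1 hm)))
      · rintro (rfl | rfl)
        · exact ⟨by omega, (hmatch 0 (by omega)).2 hi⟩
        · exact ⟨by omega, (hmatch d le_rfl).2 hdm⟩
    rw [mch, hset, Finset.card_pair hd0.ne]
  have := hτ.2 ⟨p, hcard⟩
  omega

/-- The permutation of positions turning an occurrence of `α` at position `i` into one of `β`. -/
def rearrange {j n : ℕ} (α β : Equiv.Perm (Fin j)) {i : ℕ} (h : i + j ≤ n) :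
    Equiv.Perm (Fin n) :=
  Equiv.Perm.viaEmbedding (α⁻¹ * β)
    ⟨fun a : Fin j => (⟨i + a, by have := a.isLt; omega⟩ : Fin n), fun a b hab => by
      simp only [Fin.mk.injEq] at hab
      exact Fin.ext (by omega)⟩

theorem rearrange_apply {j n : ℕ} (α β : Equiv.Perm (Fin j)) {i : ℕ} (h : i + j ≤ n)
    (a : Fin j) :
    rearrange α β h ⟨i + a, by have := a.isLt; omega⟩ =
      ⟨i + (α⁻¹ (β a) : Fin j), by have := (α⁻¹ (β a)).isLt; omega⟩ :=
  Equiv.Perm.viaEmbedding_apply (α⁻¹ * β) _ a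

theorem rearrange_mul_rearrange {j n : ℕ} (α β : Equiv.Perm (Fin j)) {i : ℕ} (h : i + j ≤ n) :
    rearrange α β h * rearrange β α h = 1 := by
  unfold rearrange
  rw [← Equiv.Perm.viaEmbeddingHom_apply, ← Equiv.Perm.viaEmbeddingHom_apply, ← map_mul]
  simp [mul_assoc]

theorem rearrange_apply_of_not_interior {j n : ℕ} (hj : 0 < j) {α β : Equiv.Perm (Fin j)}
    (h0 : α ⟨0, hj⟩ = β ⟨0, hj⟩)
    (hlast : α ⟨j - 1, Nat.sub_lt hj one_pos⟩ = β ⟨j - 1, Nat.sub_lt hj one_pos⟩)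
    {i : ℕ} (h : i + j ≤ n) (k : Fin n) (hk : (k : ℕ) ≤ i ∨ i + j ≤ (k : ℕ) + 1) :
    rearrange α β h k = k := by
  by_cases hin : i ≤ (k : ℕ) ∧ (k : ℕ) < i + j
  · obtain ⟨a, ha⟩ : ∃ a : Fin j,
        k = ⟨i + a, (Nat.add_lt_add_left a.isLt i).trans_le h⟩ :=
      ⟨⟨k - i, by omega⟩, Fin.ext (by simp; omega)⟩
    subst ha
    rw [rearrange_apply]
    have hfix : α⁻¹ (β a) = a := by
      rw [Equiv.Perm.inv_eq_iff_eq]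
      have : a = ⟨0, hj⟩ ∨ a = ⟨j - 1, Nat.sub_lt hj one_pos⟩ := by
        simp only [Fin.ext_iff]
        simp only at hk
        have := a.isLt
        omega
      rcases this with ha | ha <;> rw [ha]
      · exact h0.symm
      · exact hlast.symm
    simp only [hfix]
  · refine Equiv.Perm.viaEmbedding_apply_of_notMem _ _ _ ?_
    rintro ⟨a, rfl⟩
    exact hin ⟨Nat.le_add_right _ _, Nat.add_lt_add_left a.isLt i⟩

theorem matchAt_mul_rearrange {j n : ℕ} {α β : Equiv.Perm (Fin j)} {σ : Equiv.Perm (Fin n)}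
    {i : ℕ} (h : i + j ≤ n) (hm : MatchAt α σ i) : MatchAt β (σ * rearrange α β h) i := by
  refine ⟨h, fun a b => ?_⟩
  have := hm.2 (α⁻¹ (β a)) (α⁻¹ (β b))
  simpa [Equiv.Perm.mul_apply, rearrange_apply] using this

theorem matchAt_mul_iff_of_fixed {j n : ℕ} {τ : Equiv.Perm (Fin j)} {σ π : Equiv.Perm (Fin n)}
    {k : ℕ} (hfix : ∀ m : Fin n, k ≤ (m : ℕ) → (m : ℕ) < k + j → π m = m) :
    MatchAt τ (σ * π) k ↔ MatchAt τ σ k := by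
  refine exists_congr fun h => forall_congr' fun a => forall_congr' fun b => ?_
  have := a.isLt
  have := b.isLt
  rw [Equiv.Perm.mul_apply, Equiv.Perm.mul_apply, hfix _ (by simp) (by simp),
    hfix _ (by simp) (by simp)]

theorem des_mul_rearrange {j n : ℕ} (hj : 0 < j) {α β : Equiv.Perm (Fin j)}
    (h0 : α ⟨0, hj⟩ = β ⟨0, hj⟩)
    (hlast : α ⟨j - 1, Nat.sub_lt hj one_pos⟩ = β ⟨j - 1, Nat.sub_lt hj one_pos⟩)
    (hdes : des α = des β) {σ : Equiv.Perm (Fin n)} {i : ℕ} (h : i + j ≤ n) (hm : MatchAt α σ i) :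
    des (σ * rearrange α β h) = des σ := by
  rw [des_eq_add_of_matchAt hm, des_eq_add_of_matchAt (matchAt_mul_rearrange h hm), hdes]
  congr 2
  refine Finset.filter_congr fun k _ => and_congr_left fun hk => exists_congr fun hkn => ?_
  rw [Equiv.Perm.mul_apply, Equiv.Perm.mul_apply,
    rearrange_apply_of_not_interior hj h0 hlast h _ (by simp only; omega),
    rearrange_apply_of_not_interior hj h0 hlast h _ (by simp only; omega)]

/-- The descent polynomial of the permutations having `α`-matches at all positions in `T` and
`β`-matches at all positions in `U`. -/
def markedSum (n : ℕ) {j : ℕ} (α β : Equiv.Perm (Fin j)) (T U : Finset ℕ) : Polynomial ℚ :=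
  ∑ σ ∈ Finset.univ.filter (fun σ : Equiv.Perm (Fin n) =>
    (∀ i ∈ T, MatchAt α σ i) ∧ ∀ i ∈ U, MatchAt β σ i), Polynomial.X ^ des σ

theorem markedSum_insert_left {j n : ℕ} (hj : 0 < j) {α β : Equiv.Perm (Fin j)}
    (h0 : α ⟨0, hj⟩ = β ⟨0, hj⟩)
    (hlast : α ⟨j - 1, Nat.sub_lt hj one_pos⟩ = β ⟨j - 1, Nat.sub_lt hj one_pos⟩)
    (hdes : des α = des β) {T U : Finset ℕ} {i : ℕ}
    (hT : ∀ k ∈ T, k + j ≤ i + 1 ∨ i + j ≤ k + 1)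
    (hU : ∀ k ∈ U, k + j ≤ i + 1 ∨ i + j ≤ k + 1) :
    markedSum n α β (insert i T) U = markedSum n α β T (insert i U) := by
  by_cases h : i + j ≤ n
  swap
  · unfold markedSum
    rw [Finset.sum_eq_zero, Finset.sum_eq_zero]
    · intro σ hσ
      exact absurd ((Finset.mem_filter.1 hσ).2.2 i (Finset.mem_insert_self _ _)).1 h
    · intro σ hσ
      exact absurd ((Finset.mem_filter.1 hσ).2.1 i (Finset.mem_insert_self _ _)).1 h
  have far : ∀ (γ δ τ : Equiv.Perm (Fin j)) (_ : γ ⟨0, hj⟩ = δ ⟨0, hj⟩)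
      (_ : γ ⟨j - 1, Nat.sub_lt hj one_pos⟩ = δ ⟨j - 1, Nat.sub_lt hj one_pos⟩)
      (σ : Equiv.Perm (Fin n)) (k : ℕ)
      (_ : k + j ≤ i + 1 ∨ i + j ≤ k + 1),
      MatchAt τ (σ * rearrange γ δ h) k ↔ MatchAt τ σ k := by
    intro γ δ τ h1 h2 σ k hk
    refine matchAt_mul_iff_of_fixed fun m hm1 hm2 =>
      rearrange_apply_of_not_interior hj h1 h2 h m (by omega)
  unfold markedSum
  refine Finset.sum_bij' (fun σ _ => σ * rearrange α β h) (fun σ _ => σ * rearrange β α h)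
    ?_ ?_ ?_ ?_ ?_
  · intro σ hσ
    simp only [Finset.mem_filter, Finset.mem_univ, true_and, Finset.forall_mem_insert] at hσ ⊢
    refine ⟨fun k hk => ?_, matchAt_mul_rearrange h hσ.1.1, fun k hk => ?_⟩
    · exact (far α β α h0 hlast σ k (hT k hk)).2 (hσ.1.2 k hk)
    · exact (far α β β h0 hlast σ k (hU k hk)).2 (hσ.2 k hk)
  · intro σ hσ
    simp only [Finset.mem_filter, Finset.mem_univ, true_and, Finset.forall_mem_insert] at hσ ⊢
    refine ⟨⟨matchAt_mul_rearrange h hσ.2.1, fun k hk => ?_⟩, fun k hk => ?_⟩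
    · exact (far β α α h0.symm hlast.symm σ k (hT k hk)).2 (hσ.1 k hk)
    · exact (far β α β h0.symm hlast.symm σ k (hU k hk)).2 (hσ.2.2 k hk)
  · intro σ _
    simp only [mul_assoc, rearrange_mul_rearrange, mul_one]
  · intro σ _
    simp only [mul_assoc, rearrange_mul_rearrange, mul_one]
  · intro σ hσ
    rw [des_mul_rearrange hj h0 hlast hdes h]
    exact (Finset.mem_filter.1 hσ).2.1 i (Finset.mem_insert_self _ _)

theorem markedSum_union {j n : ℕ} (hj : 0 < j) {α β : Equiv.Perm (Fin j)}
    (h0 : α ⟨0, hj⟩ = β ⟨0, hj⟩)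
    (hlast : α ⟨j - 1, Nat.sub_lt hj one_pos⟩ = β ⟨j - 1, Nat.sub_lt hj one_pos⟩)
    (hdes : des α = des β) (T : Finset ℕ) : ∀ U : Finset ℕ, Disjoint T U →
      (∀ i ∈ T ∪ U, ∀ k ∈ T ∪ U, i < k → i + j ≤ k + 1) →
      markedSum n α β T U = markedSum n α β ∅ (T ∪ U) := by
  induction T using Finset.induction_on with
  | empty => simp
  | insert i T hi ih =>
    intro U hdisj hS
    rw [Finset.disjoint_insert_left] at hdisj
    have hsep : ∀ k ∈ T ∪ U, k + j ≤ i + 1 ∨ i + j ≤ k + 1 := by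
      intro k hk
      have hk' : k ∈ insert i T ∪ U := by
        rw [Finset.insert_union]
        exact Finset.mem_insert_of_mem hk
      have hi' : i ∈ insert i T ∪ U := by simp
      have hne : k ≠ i := by
        rintro rfl
        rcases Finset.mem_union.1 hk with hk | hk
        · exact hi hk
        · exact hdisj.1 hk
      rcases lt_or_gt_of_ne hne with hlt | hlt
      · exact Or.inl (hS k hk' i hi' hlt)
      · exact Or.inr (hS i hi' k hk' hlt)
    rw [markedSum_insert_left hj h0 hlast hdes
      (fun k hk => hsep k (Finset.mem_union_left _ hk))
      (fun k hk => hsep k (Finset.mem_union_right _ hk))]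
    have heq : T ∪ insert i U = insert i T ∪ U := by
      rw [Finset.insert_union, Finset.union_insert]
    rw [ih (insert i U) (Finset.disjoint_insert_right.2 ⟨hi, hdisj.2⟩) (by rwa [heq]), heq]

theorem markedSum_eq {j n : ℕ} (hj : 3 ≤ j) (hj0 : 0 < j) {α β : Equiv.Perm (Fin j)}
    (hα : MinOverlapping α) (hβ : MinOverlapping β) (h0 : α ⟨0, hj0⟩ = β ⟨0, hj0⟩)
    (hlast : α ⟨j - 1, Nat.sub_lt hj0 one_pos⟩ = β ⟨j - 1, Nat.sub_lt hj0 one_pos⟩)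
    (hdes : des α = des β)
    (S : Finset ℕ) : markedSum n α β S ∅ = markedSum n α β ∅ S := by
  by_cases hS : ∀ i ∈ S, ∀ k ∈ S, i < k → i + j ≤ k + 1
  · simpa using markedSum_union (n := n) hj0 h0 hlast hdes S ∅ (by simp) (by simpa using hS)
  · unfold markedSum
    rw [Finset.sum_eq_zero, Finset.sum_eq_zero]
    · intro σ hσ
      refine absurd (fun i hi k hk hik => ?_) hS
      have := (Finset.mem_filter.1 hσ).2.2
      exact hβ.le_of_matchAt hj (this i hi) (this k hk) hik
    · intro σ hσ
      refine absurd (fun i hi k hk hik => ?_) hS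
      have := (Finset.mem_filter.1 hσ).2.1
      exact hα.le_of_matchAt hj (this i hi) (this k hk) hik

/-- Inclusion-exclusion over the set of positions of matches. -/
theorem sum_NM_eq_sum_powerset (n : ℕ) {j : ℕ} (τ : Equiv.Perm (Fin j)) :
    (∑ σ ∈ NM n τ, (Polynomial.X : Polynomial ℚ) ^ des σ) =
      ∑ S ∈ (Finset.range n).powerset, (-1) ^ S.card *
        ∑ σ ∈ Finset.univ.filter (fun σ : Equiv.Perm (Fin n) => ∀ i ∈ S, MatchAt τ σ i),
          Polynomial.X ^ des σ := by
  have key : ∀ σ : Equiv.Perm (Fin n),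
      (∑ S ∈ (Finset.range n).powerset,
        if ∀ i ∈ S, MatchAt τ σ i then (-1 : Polynomial ℚ) ^ S.card else 0) =
      if mch τ σ = 0 then 1 else 0 := by
    intro σ
    have h := congrArg (Int.cast : ℤ → Polynomial ℚ) (Finset.sum_powerset_neg_one_pow_card
      (x := (Finset.range n).filter fun i => MatchAt τ σ i))
    rw [mch]
    simp only [Finset.card_eq_zero]
    push_cast at h
    rw [← h, ← Finset.sum_filter]
    refine Finset.sum_congr ?_ fun _ _ => rfl
    ext S
    simp only [Finset.mem_filter, Finset.mem_powerset, Finset.subset_iff]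
    exact ⟨fun hS i hi => ⟨hS.1 hi, hS.2 i hi⟩, fun hS => ⟨fun i hi => (hS hi).1,
      fun i hi => (hS hi).2⟩⟩
  calc (∑ σ ∈ NM n τ, (Polynomial.X : Polynomial ℚ) ^ des σ)
      = ∑ σ : Equiv.Perm (Fin n), (if mch τ σ = 0 then 1 else 0) * Polynomial.X ^ des σ := by
        simp [NM, Finset.sum_filter]
    _ = _ := by
        simp_rw [← key, Finset.sum_mul]
        rw [Finset.sum_comm]
        refine Finset.sum_congr rfl fun S _ => ?_
        rw [Finset.mul_sum, Finset.sum_filter]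
        refine Finset.sum_congr rfl fun σ _ => ?_
        split_ifs <;> simp

/-- Theorem: if `α, β ∈ S_j` (`j ≥ 3`) are minimal overlapping, both start with `1`,
end with the same element, and `des α = des β`, then for all `n ≥ 0`,
`Σ_{σ∈NM_n(α)} x^{des σ} = Σ_{σ∈NM_n(β)} x^{des σ}` as polynomials in `x`,
i.e. `α` and `β` are des-c-Wilf equivalent. -/
theorem stmt7 {j : ℕ} (hj : 3 ≤ j) (α β : Equiv.Perm (Fin j))
    (hα : MinOverlapping α) (hβ : MinOverlapping β)
    (hα1 : α ⟨0, by omega⟩ = ⟨0, by omega⟩) (hβ1 : β ⟨0, by omega⟩ = ⟨0, by omega⟩)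
    (hlast : α ⟨j - 1, by omega⟩ = β ⟨j - 1, by omega⟩)
    (hdes : des α = des β) :
    ∀ n : ℕ,
      (∑ σ ∈ NM n α, (Polynomial.X : Polynomial ℚ) ^ des σ) =
      ∑ σ ∈ NM n β, (Polynomial.X : Polynomial ℚ) ^ des σ := by
  intro n
  rw [sum_NM_eq_sum_powerset, sum_NM_eq_sum_powerset]
  refine Finset.sum_congr rfl fun S _ => ?_
  have h := markedSum_eq (n := n) hj (by omega) hα hβ (hα1.trans hβ1.symm) hlast hdes S
  simp only [markedSum, Finset.notMem_empty, false_imp_iff, implies_true, true_and,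
    and_true] at h
  rw [h]

end CWilf
end
end

section
/- Suppose j ≥ 3 and α = α_1⋯α_j and β = β_1⋯β_j are mutually minimal overlapping permutations in S_j, and there is an a with 1 ≤ a < j such that α_i = β_i for all i ≤ a, α_a = β_a = 1, α_j = β_j, and des(α) = des(β). Then for all n ≥ 0, Σ_{σ∈NM_n(α)} x^{des(σ)} y^{LRmin(σ)} = Σ_{σ∈NM_n(β)} x^{des(σ)} y^{LRmin(σ)}, as polynomials in x and y; that is, α and β are (des,LRmin)-c-Wilf equivalent. -/
open scoped Classical

noncomputable section

namespace CWilf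

/-- The word of `σ` as a function on `ℕ`, extended by the identity. -/
def word {n : ℕ} (σ : Equiv.Perm (Fin n)) : ℕ → ℕ := fun i => if h : i < n then σ ⟨i, h⟩ else i

lemma word_lt {n : ℕ} (σ : Equiv.Perm (Fin n)) {i : ℕ} (h : i < n) :
    word σ i = σ ⟨i, h⟩ := by
  simp [word, h]

lemma word_lt_of_lt {n : ℕ} (σ : Equiv.Perm (Fin n)) {i : ℕ} (h : i < n) : word σ i < n := by
  simp [word, h]

lemma word_mul {n : ℕ} (σ π : Equiv.Perm (Fin n)) (i : ℕ) :
    word (σ * π) i = word σ (word π i) := by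
  by_cases h : i < n <;> simp [word, h]

lemma word_one {n : ℕ} (i : ℕ) : word (1 : Equiv.Perm (Fin n)) i = i := by
  simp [word]

lemma word_injective {n : ℕ} {σ π : Equiv.Perm (Fin n)} (h : ∀ i < n, word σ i = word π i) :
    σ = π := by
  ext ⟨i, hi⟩
  simpa [word, hi] using h i hi

/-- The words `t` and `s(i) s(i+1) ⋯ s(i+j-1)` are order isomorphic. -/
def WordMatch (j : ℕ) (t s : ℕ → ℕ) (i : ℕ) : Prop :=
  ∀ a < j, ∀ b < j, (t a < t b ↔ s (i + a) < s (i + b))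

lemma matchAt_iff_s9 {j n : ℕ} (τ : Equiv.Perm (Fin j)) (σ : Equiv.Perm (Fin n)) (i : ℕ) :
    MatchAt τ σ i ↔ i + j ≤ n ∧ WordMatch j (word τ) (word σ) i := by
  constructor
  · rintro ⟨h, H⟩
    refine ⟨h, fun a ha b hb => ?_⟩
    rw [word_lt τ ha, word_lt τ hb, word_lt σ (by omega : i + a < n),
      word_lt σ (by omega : i + b < n)]
    exact H ⟨a, ha⟩ ⟨b, hb⟩
  · rintro ⟨h, H⟩
    refine ⟨h, fun a b => ?_⟩
    have := H a a.2 b b.2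
    rwa [word_lt τ a.2, word_lt τ b.2, word_lt σ (by omega : i + (a : ℕ) < n),
      word_lt σ (by omega : i + (b : ℕ) < n)] at this

lemma des_eq_card {n : ℕ} (σ : Equiv.Perm (Fin n)) :
    des σ = ((Finset.range (n - 1)).filter fun i => word σ (i + 1) < word σ i).card := by
  unfold des
  refine Finset.card_bij (fun i _ => (i : ℕ)) ?_ ?_ ?_
  · intro i hi
    simp only [Finset.mem_filter, Finset.mem_univ, true_and] at hi
    obtain ⟨h, hi⟩ := hi
    simp only [Finset.mem_filter, Finset.mem_range]
    refine ⟨by omega, ?_⟩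
    rw [word_lt σ h, word_lt σ i.2]
    exact hi
  · intro i _ k _ h
    exact Fin.ext h
  · intro i hi
    simp only [Finset.mem_filter, Finset.mem_range] at hi
    obtain ⟨h, hi⟩ := hi
    rw [word_lt σ (by omega : i + 1 < n), word_lt σ (by omega : i < n)] at hi
    exact ⟨⟨i, by omega⟩, by simpa using ⟨by omega, hi⟩, rfl⟩

lemma LRmin_eq_card {n : ℕ} (σ : Equiv.Perm (Fin n)) :
    LRmin σ = ((Finset.range n).filter fun k => ∀ i < k, word σ k < word σ i).card := by
  unfold LRmin
  refine Finset.card_bij (fun i _ => (i : ℕ)) ?_ ?_ ?_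
  · intro k hk
    simp only [Finset.mem_filter, Finset.mem_univ, true_and] at hk
    simp only [Finset.mem_filter, Finset.mem_range]
    refine ⟨k.2, fun i hi => ?_⟩
    rw [word_lt σ k.2, word_lt σ (by omega : i < n)]
    exact hk ⟨i, by omega⟩ hi
  · intro i _ k _ h
    exact Fin.ext h
  · intro k hk
    simp only [Finset.mem_filter, Finset.mem_range] at hk
    obtain ⟨h, hk⟩ := hk
    refine ⟨⟨k, h⟩, ?_, rfl⟩
    simp only [Finset.mem_filter, Finset.mem_univ, true_and]
    intro i hi
    have := hk i hi
    rwa [word_lt σ h, word_lt σ i.2] at this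

lemma mem_NM {j n : ℕ} (hj : 0 < j) (τ : Equiv.Perm (Fin j)) (σ : Equiv.Perm (Fin n)) :
    σ ∈ NM n τ ↔ ∀ i, ¬ MatchAt τ σ i := by
  simp only [NM, mch, Finset.mem_filter, Finset.mem_univ, true_and, Finset.card_eq_zero,
    Finset.filter_eq_empty_iff, Finset.mem_range]
  refine ⟨fun h i hi => h ?_ hi, fun h i _ => h i⟩
  have := hi.1
  omega

/-- Every factor of a permutation can be reduced. -/
lemma exists_red {n : ℕ} (σ : Equiv.Perm (Fin n)) (p m : ℕ) (h : p + m ≤ n) :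
    ∃ ρ : Equiv.Perm (Fin m), WordMatch m (word ρ) (word σ) p := by
  let f : Fin m → Fin n := fun i => σ ⟨p + i, by omega⟩
  have hf : Function.Injective f := by
    intro i k hik
    have := congrArg Fin.val (σ.injective hik)
    simp only at this
    exact Fin.ext (by omega)
  have hs : StrictMono (f ∘ Tuple.sort f) :=
    (Tuple.monotone_sort f).strictMono_of_injective (hf.comp (Tuple.sort f).injective)
  refine ⟨(Tuple.sort f)⁻¹, fun a ha b hb => ?_⟩
  rw [word_lt _ ha, word_lt _ hb, word_lt σ (by omega : p + a < n),
    word_lt σ (by omega : p + b < n)]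
  have := hs.lt_iff_lt (a := (Tuple.sort f)⁻¹ ⟨a, ha⟩) (b := (Tuple.sort f)⁻¹ ⟨b, hb⟩)
  rw [Function.comp_apply, Function.comp_apply, Equiv.Perm.inv_def, Equiv.apply_symm_apply,
    Equiv.apply_symm_apply] at this
  exact this.symm

lemma matchAt_red {j n m p : ℕ} {σ : Equiv.Perm (Fin n)} {ρ : Equiv.Perm (Fin m)}
    (h : p + m ≤ n) (hρ : WordMatch m (word ρ) (word σ) p) (τ : Equiv.Perm (Fin j)) (i : ℕ) :
    MatchAt τ ρ i ↔ i + j ≤ m ∧ MatchAt τ σ (p + i) := by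
  simp only [matchAt_iff_s9]
  have key : i + j ≤ m → (WordMatch j (word τ) (word ρ) i ↔
      WordMatch j (word τ) (word σ) (p + i)) := by
    intro hi
    refine forall₄_congr fun a ha b hb => ?_
    rw [hρ (i + a) (by omega) (i + b) (by omega), add_assoc, add_assoc]
  constructor
  · rintro ⟨h1, h2⟩
    exact ⟨h1, by omega, (key h1).1 h2⟩
  · rintro ⟨h1, -, h2⟩
    exact ⟨h1, (key h1).2 h2⟩

lemma one_le_mch {j n : ℕ} (hj : 0 < j) {τ : Equiv.Perm (Fin j)} {σ : Equiv.Perm (Fin n)} {i : ℕ}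
    (h : MatchAt τ σ i) : 1 ≤ mch τ σ := by
  refine Finset.card_pos.2 ⟨i, ?_⟩
  have := h.1
  simp only [Finset.mem_filter, Finset.mem_range]
  exact ⟨by omega, h⟩

lemma MinOverlapping.not_overlap {j : ℕ} (hj : 3 ≤ j) {τ : Equiv.Perm (Fin j)}
    (hτ : MinOverlapping τ) {n : ℕ} {σ : Equiv.Perm (Fin n)} {p d : ℕ} (hd : 0 < d)
    (hdj : d < j - 1) (hp : MatchAt τ σ p) (hq : MatchAt τ σ (p + d)) : False := by
  induction d using Nat.strong_induction_on with
  | _ d ih =>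
    have h1 := hq.1
    have hw : p + (d + j) ≤ n := by omega
    obtain ⟨ρ, hρ⟩ := exists_red σ p (d + j) hw
    have hm := matchAt_red hw hρ τ
    have hset : (Finset.range (d + j)).filter (fun i => MatchAt τ ρ i) = {0, d} := by
      ext i
      simp only [Finset.mem_filter, Finset.mem_range, Finset.mem_insert, Finset.mem_singleton, hm]
      constructor
      · rintro ⟨-, h2, h3⟩
        by_contra hne
        exact ih i (by omega) (by omega) (by omega) h3
      · rintro (rfl | rfl)
        · exact ⟨by omega, by omega, hp⟩
        · exact ⟨by omega, le_rfl, hq⟩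
    have h2 : mch τ ρ = 2 := by
      rw [mch, hset, Finset.card_pair (by omega)]
    have := hτ.2 ⟨ρ, h2⟩
    omega

lemma MutuallyMinOverlapping.far {j : ℕ} (hj : 3 ≤ j) {α β : Equiv.Perm (Fin j)}
    (h : MutuallyMinOverlapping α β) {n : ℕ} {σ : Equiv.Perm (Fin n)} {p q : ℕ}
    (hp : MatchAt α σ p) (hq : MatchAt β σ q) : p + (j - 1) ≤ q ∨ q + (j - 1) ≤ p := by
  by_contra hc
  have h1 := hp.1
  have h2 := hq.1
  have hw : min p q + (max p q - min p q + j) ≤ n := by omega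
  obtain ⟨ρ, hρ⟩ := exists_red σ _ _ hw
  have hα : MatchAt α ρ (p - min p q) := by
    rw [matchAt_red hw hρ]
    refine ⟨by omega, ?_⟩
    rwa [Nat.add_sub_cancel' (min_le_left p q)]
  have hβ : MatchAt β ρ (q - min p q) := by
    rw [matchAt_red hw hρ]
    refine ⟨by omega, ?_⟩
    rwa [Nat.add_sub_cancel' (min_le_right p q)]
  have := h.2.2.2 ⟨ρ, one_le_mch (by omega) hα, one_le_mch (by omega) hβ⟩
  omega

lemma MinOverlapping.far {j : ℕ} (hj : 3 ≤ j) {τ : Equiv.Perm (Fin j)}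
    (h : MinOverlapping τ) {n : ℕ} {σ : Equiv.Perm (Fin n)} {p q : ℕ} (hpq : p ≠ q)
    (hp : MatchAt τ σ p) (hq : MatchAt τ σ q) : p + (j - 1) ≤ q ∨ q + (j - 1) ≤ p := by
  by_contra hc
  rcases Nat.lt_or_gt_of_ne hpq with hlt | hlt
  · exact h.not_overlap hj (p := p) (d := q - p) (by omega) (by omega) hp
      (by rwa [Nat.add_sub_cancel' hlt.le])
  · exact h.not_overlap hj (p := q) (d := p - q) (by omega) (by omega) hq
      (by rwa [Nat.add_sub_cancel' hlt.le])

/-- The windows `[p, p + k]`, `p ∈ W`, meet at most in their endpoints. -/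
def Separated (k : ℕ) (W : Set ℕ) : Prop :=
  ∀ p ∈ W, ∀ q ∈ W, p ≠ q → p + k ≤ q ∨ q + k ≤ p

/-- `u` acts on `[0, k]` and fixes both endpoints. -/
structure FixesEnds (k : ℕ) (u : ℕ → ℕ) : Prop where
  zero : u 0 = 0
  last : u k = k
  lt : ∀ c < k, u c < k

lemma FixesEnds.le {k : ℕ} {u : ℕ → ℕ} (hu : FixesEnds k u) {c : ℕ} (hc : c ≤ k) : u c ≤ k := by
  rcases hc.lt_or_eq with h | rfl
  · exact (hu.lt c h).le
  · exact hu.last.le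

/-- Act by `u p` on the interior of each window `[p, p + k]`, `p ∈ W`. -/
def windowMap (k : ℕ) (W : Set ℕ) (u : ℕ → ℕ → ℕ) (i : ℕ) : ℕ :=
  if h : ∃ p ∈ W, p < i ∧ i < p + k then h.choose + u h.choose (i - h.choose) else i

section windowMap

variable {k : ℕ} {W : Set ℕ} {u v : ℕ → ℕ → ℕ}

lemma windowMap_of_not {i : ℕ} (h : ¬ ∃ p ∈ W, p < i ∧ i < p + k) : windowMap k W u i = i := by
  simp [windowMap, h]

lemma windowMap_congr (h : ∀ p ∈ W, u p = v p) : windowMap k W u = windowMap k W v := by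
  funext i
  unfold windowMap
  split_ifs with h'
  · rw [h _ h'.choose_spec.1]
  · rfl

lemma windowMap_add (hW : Separated k W) (hu : ∀ p, FixesEnds k (u p)) {p c : ℕ} (hp : p ∈ W)
    (hc : c ≤ k) : windowMap k W u (p + c) = p + u p c := by
  by_cases h : ∃ q ∈ W, q < p + c ∧ p + c < q + k
  · have heq : h.choose = p := by
      obtain ⟨h1, h2, h3⟩ := h.choose_spec
      by_contra hne
      have := hW _ h1 p hp hne
      omega
    simp only [windowMap, dif_pos h]
    rw [heq, Nat.add_sub_cancel_left]
  · rw [windowMap_of_not h]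
    have : c = 0 ∨ c = k := by
      by_contra hne
      exact h ⟨p, hp, by omega, by omega⟩
    rcases this with rfl | rfl
    · rw [(hu p).zero]
    · rw [(hu p).last]

lemma windowMap_leftInverse (hW : Separated k W) (hu : ∀ p, FixesEnds k (u p))
    (hv : ∀ p, FixesEnds k (v p)) (huv : ∀ p c, v p (u p c) = c) :
    Function.LeftInverse (windowMap k W v) (windowMap k W u) := by
  intro i
  by_cases h : ∃ p ∈ W, p < i ∧ i < p + k
  · obtain ⟨p, hp, h1, h2⟩ := h
    obtain ⟨c, rfl⟩ := Nat.exists_eq_add_of_lt h1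
    rw [add_assoc, windowMap_add hW hu hp (by omega),
      windowMap_add hW hv hp ((hu p).le (by omega)), huv]
  · rw [windowMap_of_not h, windowMap_of_not h]

lemma windowMap_lt {n : ℕ} (hW : Separated k W) (hu : ∀ p, FixesEnds k (u p))
    (hn : ∀ p ∈ W, p + k < n) {i : ℕ} (hi : i < n) : windowMap k W u i < n := by
  by_cases h : ∃ p ∈ W, p < i ∧ i < p + k
  · obtain ⟨p, hp, h1, h2⟩ := h
    obtain ⟨c, rfl⟩ := Nat.exists_eq_add_of_lt h1
    rw [add_assoc, windowMap_add hW hu hp (by omega)]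
    have := (hu p).lt (c + 1) (by omega)
    have := hn p hp
    omega
  · rwa [windowMap_of_not h]

/-- If each `u p` fixes `[0, a)`, then `windowMap` preserves the initial segments that end
outside the moved parts of the windows. -/
lemma windowMap_lt_of_lt (hW : Separated k W) (hu : ∀ p, FixesEnds k (u p)) {a m : ℕ}
    (hfix : ∀ p, ∀ c < a, u p c = c) (hm : ¬ ∃ p ∈ W, p + a ≤ m ∧ m < p + k)
    {i : ℕ} (hi : i < m) : windowMap k W u i < m := by
  by_cases h : ∃ p ∈ W, p < i ∧ i < p + k
  · obtain ⟨p, hp, h1, h2⟩ := h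
    obtain ⟨c, rfl⟩ := Nat.exists_eq_add_of_lt h1
    rw [add_assoc, windowMap_add hW hu hp (by omega)]
    by_cases hlt : p + k ≤ m
    · have := (hu p).lt (c + 1) (by omega)
      omega
    · have : ¬ p + a ≤ m := fun h3 => hm ⟨p, hp, h3, by omega⟩
      rw [hfix p (c + 1) (by omega)]
      omega
  · rwa [windowMap_of_not h]

/-- The window whose edges `(i, i + 1)` contain the one starting at `i`, if any. -/
def owner (k : ℕ) (W : Set ℕ) (i : ℕ) : Option ℕ :=
  if h : ∃ p ∈ W, p ≤ i ∧ i < p + k then some h.choose else none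

lemma owner_eq_none {i : ℕ} : owner k W i = none ↔ ¬ ∃ p ∈ W, p ≤ i ∧ i < p + k := by
  simp [owner]

lemma owner_eq_some (hW : Separated k W) {i p : ℕ} :
    owner k W i = some p ↔ p ∈ W ∧ p ≤ i ∧ i < p + k := by
  constructor
  · intro h
    unfold owner at h
    split_ifs at h with h'
    rw [← Option.some.inj h]
    exact h'.choose_spec
  · rintro ⟨h1, h2, h3⟩
    have h' : ∃ p ∈ W, p ≤ i ∧ i < p + k := ⟨p, h1, h2, h3⟩
    rw [owner, dif_pos h', Option.some_inj]
    obtain ⟨h4, h5, h6⟩ := h'.choose_spec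
    by_contra hne
    have := hW _ h4 p h1 hne
    omega

lemma card_descents_window (hW : Separated k W) {n p : ℕ} (hp : p ∈ W) (hn : p + k < n)
    (s : ℕ → ℕ) :
    (((Finset.range (n - 1)).filter fun i => s (i + 1) < s i).filter
      fun i => owner k W i = some p).card =
    ((Finset.range k).filter fun c => s (p + (c + 1)) < s (p + c)).card := by
  refine (Finset.card_bij (fun c _ => p + c) ?_ ?_ ?_).symm
  · intro c hc
    simp only [Finset.mem_filter, Finset.mem_range, owner_eq_some hW] at hc ⊢
    exact ⟨⟨by omega, hc.2⟩, hp, by omega, by omega⟩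
  · intro c _ d _ h
    exact Nat.add_left_cancel h
  · intro i hi
    simp only [Finset.mem_filter, Finset.mem_range, owner_eq_some hW] at hi
    obtain ⟨⟨h1, h2⟩, -, h3, h4⟩ := hi
    obtain ⟨c, rfl⟩ := Nat.exists_eq_add_of_le h3
    refine ⟨c, ?_, rfl⟩
    simp only [Finset.mem_filter, Finset.mem_range]
    exact ⟨by omega, h2⟩

lemma card_descents_windowMap (hW : Separated k W) (hu : ∀ p, FixesEnds k (u p)) {n : ℕ}
    (hn : ∀ p ∈ W, p + k < n) (s : ℕ → ℕ)
    (hs : ∀ p ∈ W, ((Finset.range k).filter fun c => s (p + u p (c + 1)) < s (p + u p c)).card =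
      ((Finset.range k).filter fun c => s (p + (c + 1)) < s (p + c)).card) :
    ((Finset.range (n - 1)).filter
      fun i => s (windowMap k W u (i + 1)) < s (windowMap k W u i)).card =
    ((Finset.range (n - 1)).filter fun i => s (i + 1) < s i).card := by
  have hmaps : ∀ i ∈ Finset.range (n - 1),
      owner k W i ∈ (Finset.range (n - 1)).image (owner k W) :=
    fun i hi => Finset.mem_image_of_mem _ hi
  rw [Finset.card_eq_sum_card_fiberwise (f := owner k W)
      (t := (Finset.range (n - 1)).image (owner k W))
      fun i hi => hmaps i (Finset.mem_filter.1 hi).1,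
    Finset.card_eq_sum_card_fiberwise (f := owner k W)
      (t := (Finset.range (n - 1)).image (owner k W))
      fun i hi => hmaps i (Finset.mem_filter.1 hi).1]
  refine Finset.sum_congr rfl fun b hb => ?_
  obtain ⟨i₀, -, rfl⟩ := Finset.mem_image.1 hb
  cases ho : owner k W i₀ with
  | none =>
    congr 1
    ext i
    simp only [Finset.mem_filter]
    refine and_congr_left fun hi => and_congr_right fun _ => ?_
    rw [owner_eq_none] at hi
    rw [windowMap_of_not, windowMap_of_not]
    · exact fun ⟨p, hp, h1, h2⟩ => hi ⟨p, hp, by omega, by omega⟩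
    · exact fun ⟨p, hp, h1, h2⟩ => hi ⟨p, hp, by omega, by omega⟩
  | some p =>
    have hp := ((owner_eq_some hW).1 ho).1
    rw [card_descents_window hW hp (hn p hp) s, ← hs p hp,
      card_descents_window hW hp (hn p hp) fun i => s (windowMap k W u i)]
    congr 1
    refine Finset.filter_congr fun c hc => ?_
    have := Finset.mem_range.1 hc
    rw [windowMap_add hW hu hp (by omega), windowMap_add hW hu hp (by omega)]

lemma card_LRmin_windowMap (hW : Separated k W) (hu : ∀ p, FixesEnds k (u p))
    (hv : ∀ p, FixesEnds k (v p)) (huv : ∀ p c, v p (u p c) = c) (hvu : ∀ p c, u p (v p c) = c)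
    {a n : ℕ} (hak : a < k) (hfix : ∀ p, ∀ c < a + 1, u p c = c) (s : ℕ → ℕ)
    (hs : ∀ p ∈ W, ∀ c ≤ k, s (p + a) ≤ s (p + c)) :
    ((Finset.range n).filter
      fun m => ∀ i < m, s (windowMap k W u m) < s (windowMap k W u i)).card =
    ((Finset.range n).filter fun m => ∀ i < m, s m < s i).card := by
  congr 1
  refine Finset.filter_congr fun m _ => ?_
  by_cases hm : ∃ p ∈ W, p + (a + 1) ≤ m ∧ m < p + k
  · obtain ⟨p, hp, h1, h2⟩ := hm
    obtain ⟨c, rfl⟩ := Nat.exists_eq_add_of_le (by omega : p ≤ m)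
    refine iff_of_false (fun h => ?_) fun h => ?_
    · have h3 := h (p + a) (by omega)
      rw [windowMap_add hW hu hp (by omega), windowMap_add hW hu hp (by omega),
        hfix p a (by omega)] at h3
      have := hs p hp (u p c) ((hu p).le (by omega))
      omega
    · have h3 := h (p + a) (by omega)
      have := hs p hp c (by omega)
      omega
  · have hfix' : ∀ p, ∀ c < a + 1, v p c = c := fun p c hc => by
      conv_lhs => rw [← hfix p c hc]
      exact huv p c
    have hmm : windowMap k W u m = m := by
      by_cases h : ∃ p ∈ W, p < m ∧ m < p + k
      · obtain ⟨p, hp, h1, h2⟩ := h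
        obtain ⟨c, rfl⟩ := Nat.exists_eq_add_of_le h1.le
        rw [windowMap_add hW hu hp (by omega), hfix p c]
        by_contra hc
        exact hm ⟨p, hp, by omega, h2⟩
      · exact windowMap_of_not h
    rw [hmm]
    constructor
    · intro h i hi
      have := h _ (windowMap_lt_of_lt hW hv hfix' hm hi)
      rwa [windowMap_leftInverse hW hv hu hvu i] at this
    · exact fun h i hi => h _ (windowMap_lt_of_lt hW hu hfix hm hi)

end windowMap

section swap

variable {j n : ℕ} {α β : Equiv.Perm (Fin j)}

/-- The positions in `σ` of the `α`-matches and `β`-matches. -/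
def matchSet (α β : Equiv.Perm (Fin j)) (σ : Equiv.Perm (Fin n)) : Set ℕ :=
  {p | MatchAt α σ p ∨ MatchAt β σ p}

/-- The rearrangement that turns an `α`-match into a `β`-match and conversely. -/
def exchange (α β : Equiv.Perm (Fin j)) (σ : Equiv.Perm (Fin n)) (p : ℕ) : Equiv.Perm (Fin j) :=
  if MatchAt α σ p then α⁻¹ * β else β⁻¹ * α

lemma word_inv_mul {γ : Equiv.Perm (Fin j)} (c : ℕ) : word γ⁻¹ (word γ c) = c := by
  rw [← word_mul, inv_mul_cancel, word_one]

lemma word_mul_inv {γ : Equiv.Perm (Fin j)} (c : ℕ) : word γ (word γ⁻¹ c) = c := by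
  rw [← word_mul, mul_inv_cancel, word_one]

lemma word_inv_mul_eq_self {c : ℕ} (h : word α c = word β c) : word (α⁻¹ * β) c = c := by
  rw [word_mul, ← h, word_inv_mul]

lemma fixesEnds_inv_mul (hj : 0 < j) (h0 : word α 0 = word β 0)
    (hl : word α (j - 1) = word β (j - 1)) : FixesEnds (j - 1) (word (α⁻¹ * β)) := by
  refine ⟨word_inv_mul_eq_self h0, word_inv_mul_eq_self hl, fun c hc => ?_⟩
  have h1 := word_lt_of_lt (α⁻¹ * β) (by omega : c < j)
  have h2 : word (α⁻¹ * β) c ≠ j - 1 := by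
    intro h
    have := congrArg (word (α⁻¹ * β)⁻¹) (h.trans (word_inv_mul_eq_self hl).symm)
    rw [word_inv_mul, word_inv_mul] at this
    omega
  omega

lemma fixesEnds_exchange (hj : 0 < j) (h0 : word α 0 = word β 0)
    (hl : word α (j - 1) = word β (j - 1)) (σ : Equiv.Perm (Fin n)) (p : ℕ) :
    FixesEnds (j - 1) (word (exchange α β σ p)) := by
  unfold exchange
  split_ifs
  · exact fixesEnds_inv_mul hj h0 hl
  · exact fixesEnds_inv_mul hj h0.symm hl.symm

lemma fixesEnds_exchange_inv (hj : 0 < j) (h0 : word α 0 = word β 0)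
    (hl : word α (j - 1) = word β (j - 1)) (σ : Equiv.Perm (Fin n)) (p : ℕ) :
    FixesEnds (j - 1) (word (exchange α β σ p)⁻¹) := by
  unfold exchange
  split_ifs
  · rw [mul_inv_rev, inv_inv]
    exact fixesEnds_inv_mul hj h0.symm hl.symm
  · rw [mul_inv_rev, inv_inv]
    exact fixesEnds_inv_mul hj h0 hl

lemma MutuallyMinOverlapping.separated (hj : 3 ≤ j) (h : MutuallyMinOverlapping α β)
    (σ : Equiv.Perm (Fin n)) : Separated (j - 1) (matchSet α β σ) := by
  rintro p (hp | hp) q (hq | hq) hpq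
  · exact h.1.far hj hpq hp hq
  · exact h.far hj hp hq
  · exact (h.far hj hq hp).symm
  · exact h.2.1.far hj hpq hp hq

lemma MutuallyMinOverlapping.not_both (hj : 3 ≤ j) (h : MutuallyMinOverlapping α β)
    (σ : Equiv.Perm (Fin n)) {p : ℕ} (hα : MatchAt α σ p) (hβ : MatchAt β σ p) : False := by
  have := h.far hj hα hβ
  omega

lemma matchSet_lt (hj : 0 < j) {σ : Equiv.Perm (Fin n)} {p : ℕ} (hp : p ∈ matchSet α β σ) :
    p + (j - 1) < n := by
  have : p + j ≤ n := hp.elim (fun h => h.1) fun h => h.1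
  omega

/-- The map on positions that exchanges all `α`-matches and `β`-matches of `σ`. -/
def swapMap (α β : Equiv.Perm (Fin j)) (σ : Equiv.Perm (Fin n)) : ℕ → ℕ :=
  windowMap (j - 1) (matchSet α β σ) fun p => word (exchange α β σ p)

lemma swapMap_lt (hj : 3 ≤ j) (h : MutuallyMinOverlapping α β) (h0 : word α 0 = word β 0)
    (hl : word α (j - 1) = word β (j - 1)) (σ : Equiv.Perm (Fin n)) {i : ℕ} (hi : i < n) :
    swapMap α β σ i < n :=
  windowMap_lt (h.separated hj σ) (fixesEnds_exchange (by omega) h0 hl σ)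
    (fun _ hp => matchSet_lt (by omega) hp) hi

lemma exists_swap (hj : 3 ≤ j) (h : MutuallyMinOverlapping α β) (h0 : word α 0 = word β 0)
    (hl : word α (j - 1) = word β (j - 1)) (σ : Equiv.Perm (Fin n)) :
    ∃ σ' : Equiv.Perm (Fin n), ∀ i < n, word σ' i = word σ (swapMap α β σ i) := by
  have hW := h.separated hj σ
  have hu := fixesEnds_exchange (by omega) h0 hl σ
  let f : Fin n → Fin n := fun i => ⟨swapMap α β σ i, swapMap_lt hj h h0 hl σ i.2⟩
  have hf : Function.Injective f := fun i k hik =>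
    Fin.ext ((windowMap_leftInverse hW hu (fixesEnds_exchange_inv (by omega) h0 hl σ)
      fun p c => word_inv_mul c).injective (congrArg Fin.val hik))
  refine ⟨σ * Equiv.ofBijective f (Finite.injective_iff_bijective.1 hf), fun i hi => ?_⟩
  rw [word_mul, word_lt _ hi]
  rfl

/-- Exchange all `α`-matches and `β`-matches of `σ`. -/
def swap (hj : 3 ≤ j) (h : MutuallyMinOverlapping α β) (h0 : word α 0 = word β 0)
    (hl : word α (j - 1) = word β (j - 1)) (σ : Equiv.Perm (Fin n)) : Equiv.Perm (Fin n) :=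
  (exists_swap hj h h0 hl σ).choose

variable (hj : 3 ≤ j) (h : MutuallyMinOverlapping α β) (h0 : word α 0 = word β 0)
  (hl : word α (j - 1) = word β (j - 1)) (σ : Equiv.Perm (Fin n))

lemma word_swap {i : ℕ} (hi : i < n) : word (swap hj h h0 hl σ) i = word σ (swapMap α β σ i) :=
  (exists_swap hj h h0 hl σ).choose_spec i hi

lemma word_swap_add {p c : ℕ} (hp : p ∈ matchSet α β σ) (hc : c < j) :
    word (swap hj h h0 hl σ) (p + c) = word σ (p + word (exchange α β σ p) c) := by
  have := matchSet_lt (by omega) hp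
  rw [word_swap _ _ _ _ _ (by omega), swapMap, windowMap_add (h.separated hj σ)
    (fixesEnds_exchange (by omega) h0 hl σ) hp (by omega)]

lemma matchAt_swap {γ δ : Equiv.Perm (Fin j)} {p : ℕ} (hp : p ∈ matchSet α β σ)
    (he : exchange α β σ p = γ⁻¹ * δ) (hγ : MatchAt γ σ p) :
    MatchAt δ (swap hj h h0 hl σ) p := by
  rw [matchAt_iff_s9] at hγ ⊢
  refine ⟨hγ.1, fun a ha b hb => ?_⟩
  rw [word_swap_add hj h h0 hl σ hp ha, word_swap_add hj h h0 hl σ hp hb, he,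
    ← hγ.2 _ (word_lt_of_lt _ ha) _ (word_lt_of_lt _ hb), ← word_mul, ← word_mul,
    mul_inv_cancel_left]

lemma matchAt_swap_of_left {p : ℕ} (hp : MatchAt α σ p) : MatchAt β (swap hj h h0 hl σ) p :=
  matchAt_swap hj h h0 hl σ (Or.inl hp) (if_pos hp) hp

lemma matchAt_swap_of_right {p : ℕ} (hp : MatchAt β σ p) : MatchAt α (swap hj h h0 hl σ) p :=
  matchAt_swap hj h h0 hl σ (Or.inr hp) (if_neg fun hα => h.not_both hj σ hα hp) hp

lemma mem_matchSet_of_swap {p : ℕ} (hp : p ∈ matchSet α β (swap hj h h0 hl σ)) :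
    p ∈ matchSet α β σ := by
  by_contra hne
  have hfix : ∀ c < j, word (swap hj h h0 hl σ) (p + c) = word σ (p + c) := by
    intro c hc
    have hn := matchSet_lt (by omega) hp
    rw [word_swap _ _ _ _ _ (by omega), swapMap, windowMap_of_not]
    rintro ⟨q, hq, h1, h2⟩
    have hq' : q ∈ matchSet α β (swap hj h h0 hl σ) :=
      hq.elim (fun hq => Or.inr (matchAt_swap_of_left hj h h0 hl σ hq))
        fun hq => Or.inl (matchAt_swap_of_right hj h h0 hl σ hq)
    have := h.separated hj _ p hp q hq' fun hpq => hne (hpq ▸ hq)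
    omega
  have hmatch : ∀ τ : Equiv.Perm (Fin j), MatchAt τ (swap hj h h0 hl σ) p → MatchAt τ σ p := by
    intro τ hτ
    rw [matchAt_iff_s9] at hτ ⊢
    refine ⟨hτ.1, fun a ha b hb => ?_⟩
    rw [hτ.2 a ha b hb, hfix a ha, hfix b hb]
  exact hne (hp.imp (hmatch α) (hmatch β))

lemma matchAt_left_swap {p : ℕ} : MatchAt α (swap hj h h0 hl σ) p ↔ MatchAt β σ p := by
  refine ⟨fun hp => ?_, matchAt_swap_of_right hj h h0 hl σ⟩
  refine (mem_matchSet_of_swap hj h h0 hl σ (Or.inl hp)).resolve_left fun hα => ?_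
  exact h.not_both hj _ hp (matchAt_swap_of_left hj h h0 hl σ hα)

lemma matchAt_right_swap {p : ℕ} : MatchAt β (swap hj h h0 hl σ) p ↔ MatchAt α σ p := by
  refine ⟨fun hp => ?_, matchAt_swap_of_left hj h h0 hl σ⟩
  refine (mem_matchSet_of_swap hj h h0 hl σ (Or.inr hp)).resolve_right fun hβ => ?_
  exact h.not_both hj _ (matchAt_swap_of_right hj h h0 hl σ hβ) hp

lemma matchSet_swap : matchSet α β (swap hj h h0 hl σ) = matchSet α β σ := by
  ext p
  simp only [matchSet, Set.mem_ofPred_eq, matchAt_left_swap, matchAt_right_swap, or_comm]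

lemma exchange_swap {p : ℕ} (hp : p ∈ matchSet α β σ) :
    exchange α β (swap hj h h0 hl σ) p = (exchange α β σ p)⁻¹ := by
  unfold exchange
  rw [matchAt_left_swap]
  rcases hp with hp | hp
  · rw [if_neg fun hβ => h.not_both hj σ hp hβ, if_pos hp, mul_inv_rev, inv_inv]
  · rw [if_pos hp, if_neg fun hα => h.not_both hj σ hα hp, mul_inv_rev, inv_inv]

lemma swap_swap : swap hj h h0 hl (swap hj h h0 hl σ) = σ := by
  refine word_injective fun i hi => ?_
  have hmap : swapMap α β (swap hj h h0 hl σ) =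
      windowMap (j - 1) (matchSet α β σ) fun p => word (exchange α β σ p)⁻¹ := by
    rw [swapMap, matchSet_swap]
    exact windowMap_congr fun p hp => by rw [exchange_swap hj h h0 hl σ hp]
  rw [word_swap _ _ _ _ _ hi, word_swap _ _ _ _ _ (swapMap_lt hj h h0 hl _ hi), hmap, swapMap,
    windowMap_leftInverse (h.separated hj σ) (fixesEnds_exchange_inv (by omega) h0 hl σ)
      (fixesEnds_exchange (by omega) h0 hl σ) fun p c => word_mul_inv c]

lemma des_eq_of_match {τ : Equiv.Perm (Fin j)} {p : ℕ} (hp : MatchAt τ σ p) :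
    ((Finset.range (j - 1)).filter fun c => word σ (p + (c + 1)) < word σ (p + c)).card =
      des τ := by
  rw [des_eq_card]
  congr 1
  refine Finset.filter_congr fun c hc => ?_
  have := Finset.mem_range.1 hc
  exact (((matchAt_iff_s9 _ _ _).1 hp).2 _ (by omega) _ (by omega)).symm

lemma des_swap (hdes : des α = des β) : des (swap hj h h0 hl σ) = des σ := by
  rw [des_eq_card, des_eq_card, ← card_descents_windowMap (h.separated hj σ)
    (fixesEnds_exchange (by omega) h0 hl σ) (fun p hp => matchSet_lt (by omega) hp) (word σ)]
  · congr 1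
    refine Finset.filter_congr fun i hi => ?_
    have := Finset.mem_range.1 hi
    rw [word_swap _ _ _ _ _ (by omega), word_swap _ _ _ _ _ (by omega)]
    rfl
  · intro p hp
    trans ((Finset.range (j - 1)).filter fun c =>
      word (swap hj h h0 hl σ) (p + (c + 1)) < word (swap hj h h0 hl σ) (p + c)).card
    · congr 1
      refine Finset.filter_congr fun c hc => ?_
      have := Finset.mem_range.1 hc
      rw [word_swap_add hj h h0 hl σ hp (by omega), word_swap_add hj h h0 hl σ hp (by omega)]
    · rcases hp with hp | hp
      · rw [des_eq_of_match _ hp, des_eq_of_match _ (matchAt_swap_of_left hj h h0 hl σ hp), hdes]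
      · rw [des_eq_of_match _ hp, des_eq_of_match _ (matchAt_swap_of_right hj h h0 hl σ hp), hdes]

lemma LRmin_swap {a : ℕ} (haj : a < j - 1) (hpre : ∀ i < a + 1, word α i = word β i)
    (hαa : word α a = 0) : LRmin (swap hj h h0 hl σ) = LRmin σ := by
  have hu := fixesEnds_exchange (by omega) h0 hl σ
  rw [LRmin_eq_card, LRmin_eq_card, ← card_LRmin_windowMap (h.separated hj σ) hu
    (fixesEnds_exchange_inv (by omega) h0 hl σ) (fun p c => word_inv_mul c)
    (fun p c => word_mul_inv c) haj (n := n) _ (word σ)]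
  · congr 1
    refine Finset.filter_congr fun m hm => forall₂_congr fun i hi => ?_
    have := Finset.mem_range.1 hm
    rw [word_swap _ _ _ _ _ (by omega), word_swap _ _ _ _ _ (by omega)]
    rfl
  · have hmin : ∀ τ : Equiv.Perm (Fin j), word τ a = 0 → ∀ p, MatchAt τ σ p → ∀ c ≤ j - 1,
        word σ (p + a) ≤ word σ (p + c) := by
      intro τ hτ p hp c hc
      have := ((matchAt_iff_s9 _ _ _).1 hp).2 c (by omega) a (by omega)
      omega
    exact fun p hp => hp.elim (hmin α hαa p) (hmin β (hpre a (by omega) ▸ hαa) p)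
  · intro p c hc
    unfold exchange
    split_ifs
    · exact word_inv_mul_eq_self (hpre c hc)
    · exact word_inv_mul_eq_self (hpre c hc).symm

end swap

/-- Theorem: if `α, β ∈ S_j` (`j ≥ 3`) are mutually minimal overlapping, agree in
positions `1, …, a` (1-based) where `α_a = β_a = 1` and `1 ≤ a < j`, end with the same
element, and `des α = des β`, then for all `n ≥ 0`,
`Σ_{σ∈NM_n(α)} x^{des σ} y^{LRmin σ} = Σ_{σ∈NM_n(β)} x^{des σ} y^{LRmin σ}` as
polynomials in `x` (= `X 0`) and `y` (= `X 1`), i.e. `α` and `β` are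
(des,LRmin)-c-Wilf equivalent. -/
theorem stmt9 {j : ℕ} (hj : 3 ≤ j) (α β : Equiv.Perm (Fin j))
    (hmm : MutuallyMinOverlapping α β)
    (a : ℕ) (ha1 : 1 ≤ a) (haj : a < j)
    (hpre : ∀ i : ℕ, ∀ hi : i < a, α ⟨i, by omega⟩ = β ⟨i, by omega⟩)
    (hαa : α ⟨a - 1, by omega⟩ = ⟨0, by omega⟩)
    (hβa : β ⟨a - 1, by omega⟩ = ⟨0, by omega⟩)
    (hlast : α ⟨j - 1, by omega⟩ = β ⟨j - 1, by omega⟩)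
    (hdes : des α = des β) :
    ∀ n : ℕ,
      (∑ σ ∈ NM n α,
        (MvPolynomial.X 0 : MvPolynomial (Fin 2) ℚ) ^ des σ * MvPolynomial.X 1 ^ LRmin σ) =
      ∑ σ ∈ NM n β,
        (MvPolynomial.X 0 : MvPolynomial (Fin 2) ℚ) ^ des σ * MvPolynomial.X 1 ^ LRmin σ := by
  intro n
  have hpre' : ∀ i < a - 1 + 1, word α i = word β i := fun i hi => by
    rw [word_lt α (by omega : i < j), word_lt β (by omega : i < j), hpre i (by omega)]
  have h0 := hpre' 0 (by omega)
  have hl : word α (j - 1) = word β (j - 1) := by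
    rw [word_lt α (by omega : j - 1 < j), word_lt β (by omega : j - 1 < j), hlast]
  have hα0 : word α (a - 1) = 0 := by
    rw [word_lt α (by omega : a - 1 < j), hαa]
  refine Finset.sum_nbij' (swap hj hmm h0 hl) (swap hj hmm h0 hl) ?_ ?_
    (fun σ _ => swap_swap hj hmm h0 hl σ) (fun σ _ => swap_swap hj hmm h0 hl σ) ?_
  · intro σ hσ
    rw [mem_NM (by omega)] at hσ ⊢
    exact fun i hi => hσ i ((matchAt_right_swap hj hmm h0 hl σ).1 hi)
  · intro σ hσ
    rw [mem_NM (by omega)] at hσ ⊢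
    exact fun i hi => hσ i ((matchAt_left_swap hj hmm h0 hl σ).1 hi)
  · intro σ _
    rw [des_swap hj hmm h0 hl σ hdes, LRmin_swap hj hmm h0 hl σ (by omega) hpre' hα0]

end CWilf
end
end
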